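/- Let G₁ and G₂ be groups and suppose there exists a finitely presented normal fibre product H ≤ G₁ × G₂ of co-rank n, that is: both coordinate projections map H onto G₁ and G₂, H contains G₁' × G₂', H is finitely presented as an abstract group, and the torsion-free rank of the finitely generated abelian group (G₁ × G₂)/H equals n. Then for every integer m with 0 < m < n there exists a finitely presented normal fibre product Ĥ ≤ G₁ × G₂ of co-rank m. -/

import Mathlib

/-- A group is finitely presented if it is the quotient of a finitely generated free group
by the normal closure of finitely many relators. -/
def FinitelyPresentedGroup (G : Type*) [Group G] : Prop :=
  ∃ (n : ℕ) (f : FreeGroup (Fin n) →* G) (S : Finset (FreeGroup (Fin n))),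
    Function.Surjective f ∧ f.ker = Subgroup.normalClosure (S : Set (FreeGroup (Fin n)))

/-- The torsion-free rank of the abelianization of `G`, i.e. `rk G/G'`. -/
noncomputable def rkAb (G : Type*) [Group G] : ℕ :=
  Module.finrank ℤ (Additive (Abelianization G))

/-- The torsion-free rank of the quotient `G ⧸ K` (for `K` a normal subgroup). -/
noncomputable def rkQuot {G : Type*} [Group G] (K : Subgroup G) (hK : K.Normal) : ℕ :=
  letI := hK
  rkAb (G ⧸ K)

theorem fp_iff (G : Type*) [Group G] : FinitelyPresentedGroup G ↔ Group.IsFinitelyPresented G := by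
  rw [Group.isFinitelyPresented_iff]
  constructor
  · rintro ⟨n, f, S, hf, hk⟩
    exact ⟨n, f, hf, S, S.finite_toSet, hk.symm⟩
  · rintro ⟨n, f, hf, S, hS, hk⟩
    exact ⟨n, f, hS.toFinset, hf, by simpa using hk.symm⟩

theorem fg_of_fp (G : Type*) [Group G] (h : FinitelyPresentedGroup G) : Group.FG G := by
  obtain ⟨n, f, S, hf, hk⟩ := h
  exact Group.fg_of_surjective hf

open Monoid.Coprod in
theorem fp_semidirect {N : Type*} [Group N] (hN : FinitelyPresentedGroup N)
    (φ : Multiplicative ℤ →* MulAut N) :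
    Group.IsFinitelyPresented (N ⋊[φ] Multiplicative ℤ) := by
  have hfg := fg_of_fp N hN
  have := (fp_iff N).1 hN
  obtain ⟨X, hX⟩ := Group.fg_def.1 hfg
  set t : Multiplicative ℤ := Multiplicative.ofAdd 1 with ht
  let r : N → Monoid.Coprod N (Multiplicative ℤ) := fun x =>
    inr t * inl x * (inr t)⁻¹ * (inl (φ t x))⁻¹
  let R : Subgroup (Monoid.Coprod N (Multiplicative ℤ)) := Subgroup.normalClosure (r '' X)
  let p : Monoid.Coprod N (Multiplicative ℤ) →* N ⋊[φ] Multiplicative ℤ :=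
    lift SemidirectProduct.inl SemidirectProduct.inr
  have hp : Function.Surjective p := by
    intro x
    refine ⟨inl x.left * inr x.right, ?_⟩
    simp [p]
  refine Group.IsFinitelyPresented.of_surjective p hp ⟨r '' X, X.finite_toSet.image _, ?_⟩
  change R = p.ker
  apply le_antisymm
  · apply Subgroup.normalClosure_le_normal
    rintro _ ⟨x, -, rfl⟩
    simp only [SetLike.mem_coe, MonoidHom.mem_ker, r, p, map_mul, map_inv, lift_apply_inl,
      lift_apply_inr]
    rw [SemidirectProduct.inl_aut]
    simp
  · let q := QuotientGroup.mk' R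
    have h1 : (q.comp inl).comp (φ t).toMonoidHom
        = (MulAut.conj (q (inr t))).toMonoidHom.comp (q.comp inl) := by
      refine MonoidHom.eq_of_eqOn_dense hX ?_
      intro x hx
      have : q (r x) = 1 := by
        rw [← MonoidHom.mem_ker, QuotientGroup.ker_mk']
        exact Subgroup.subset_normalClosure ⟨x, hx, rfl⟩
      simp only [r, map_mul, map_inv] at this
      simpa using (mul_inv_eq_one.1 this).symm
    have h2 : ∀ n : N, q (inl (φ t n)) = q (inr t) * q (inl n) * (q (inr t))⁻¹ := fun n => by
      simpa using DFunLike.congr_fun h1 n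
    have h3 : ∀ (k : ℤ) (n : N), q (inl (φ (t ^ k) n))
        = q (inr (t ^ k)) * q (inl n) * (q (inr (t ^ k)))⁻¹ := by
      intro k
      induction k using Int.induction_on with
      | zero => intro n; simp
      | succ i ih =>
        intro n
        have : φ (t ^ ((i : ℤ) + 1)) n = φ (t ^ (i : ℤ)) (φ t n) := by
          rw [zpow_add_one, map_mul]; rfl
        rw [this, ih, h2, zpow_add_one, map_mul, map_mul]
        group
      | pred i ih =>
        intro n
        have e : φ (t ^ (-(i : ℤ) - 1)) n = φ (t ^ (-(i : ℤ))) ((φ t)⁻¹ n) := by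
          rw [zpow_sub_one, map_mul, map_inv]; rfl
        have e2 := h2 ((φ t)⁻¹ n)
        rw [MulAut.apply_inv_self] at e2
        rw [e, ih, zpow_sub_one, map_mul, map_mul, e2, map_inv, map_inv]
        group
    have h4 : ∀ g : Multiplicative ℤ, (q.comp inl).comp (φ g).toMonoidHom
        = (MulAut.conj ((q.comp inr) g)).toMonoidHom.comp (q.comp inl) := by
      intro g
      have hg : g = t ^ (Multiplicative.toAdd g) := by
        rw [ht, ← ofAdd_zsmul]; simp
      ext n
      rw [hg]
      exact h3 (Multiplicative.toAdd g) n
    have h5 : (SemidirectProduct.lift (q.comp inl) (q.comp inr) h4).comp p = q := by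
      apply Monoid.Coprod.hom_ext
      · ext n; simp [p]
      · apply MonoidHom.ext; intro n; simp [p]
    intro x hx
    rw [← QuotientGroup.ker_mk' R, MonoidHom.mem_ker]
    change q x = 1
    rw [← h5, MonoidHom.comp_apply, MonoidHom.mem_ker.1 hx, map_one]

theorem rkQuot_eq {G B : Type*} [Group G] [CommGroup B] (K : Subgroup G) (hK : K.Normal)
    (f : G →* B) (hf : Function.Surjective f) (hk : f.ker = K) :
    rkQuot K hK = Module.finrank ℤ (Additive B) := by
  subst hk
  have e : Abelianization (G ⧸ f.ker) ≃* B :=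
    ((QuotientGroup.quotientKerEquivOfSurjective f hf).abelianizationCongr).trans
      Abelianization.equivOfComm.symm
  exact LinearEquiv.finrank_eq (MulEquiv.toAdditive e).toIntLinearEquiv

theorem exists_nontorsion {A : Type*} [AddCommGroup A] (n : ℕ) (h : Module.finrank ℤ A = n + 1) :
    ∃ a : A, (∀ k : ℤ, k • a = 0 → k = 0) ∧ Module.finrank ℤ (A ⧸ Submodule.span ℤ {a}) = n := by
  have hr : Module.rank ℤ A = (n + 1 : ℕ) := by
    rw [Module.finrank] at h
    exact (Cardinal.toNat_eq_iff (by omega)).1 h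
  have h0 : Module.rank ℤ A ≠ 0 := by rw [hr]; simp
  rw [Ne, rank_eq_zero_iff] at h0
  push Not at h0
  obtain ⟨a, ha⟩ := h0
  have ha' : ∀ k : ℤ, k • a = 0 → k = 0 := fun k hk => by
    by_contra hne; exact ha k hne hk
  refine ⟨a, ha', ?_⟩
  have h1 := rank_quotient_add_rank_of_isDomain (Submodule.span ℤ {a})
  have h2 : Module.rank ℤ (Submodule.span ℤ {a}) = 1 := by
    have hli : LinearIndependent ℤ (fun _ : Unit => a) := by
      rw [Fintype.linearIndependent_iff]
      intro c hc i
      exact ha' (c i) (by simpa using hc)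
    have := rank_span hli
    rw [Set.range_const] at this
    simpa using this
  rw [h2, hr] at h1
  push_cast at h1
  have := Cardinal.add_one_inj.1 h1
  rw [Module.finrank, this]; simp

theorem step {G : Type*} [Group G] (H : Subgroup G) (hHn : H.Normal)
    (hc : commutator G ≤ H) (hfp : FinitelyPresentedGroup H) (n : ℕ)
    (hrk : rkQuot H hHn = n + 1) :
    ∃ (H' : Subgroup G) (hH'n : H'.Normal), H ≤ H' ∧ FinitelyPresentedGroup H' ∧
      rkQuot H' hH'n = n := by
  let f : G →* Abelianization (G ⧸ H) := Abelianization.of.comp (QuotientGroup.mk' H)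
  have hf : Function.Surjective f :=
    (QuotientGroup.mk_surjective).comp (QuotientGroup.mk'_surjective H)
  have hk : f.ker = H := by
    rw [← MonoidHom.comap_ker, Abelianization.ker_of]
    have : commutator (G ⧸ H) = ⊥ := by
      rw [commutator_def, ← Subgroup.map_top_of_surjective _ (QuotientGroup.mk'_surjective H),
        ← Subgroup.map_commutator, ← commutator_def, eq_bot_iff]
      rintro _ ⟨x, hx, rfl⟩
      exact (QuotientGroup.eq_one_iff x).2 (hc hx)
    rw [this, MonoidHom.comap_bot, QuotientGroup.ker_mk']
  obtain ⟨a, ha, hq⟩ := exists_nontorsion (A := Additive (Abelianization (G ⧸ H))) n hrk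
  obtain ⟨t, ht⟩ := hf a.toMul
  let g : G →* Multiplicative (Additive (Abelianization (G ⧸ H)) ⧸ Submodule.span ℤ {a}) :=
    (AddMonoidHom.toMultiplicativeRight
      (Submodule.mkQ (Submodule.span ℤ {a})).toAddMonoidHom).comp f
  have hg : Function.Surjective g := by
    intro x
    obtain ⟨y, hy⟩ := Submodule.mkQ_surjective _ (Multiplicative.toAdd x)
    obtain ⟨z, hz⟩ := hf y.toMul
    refine ⟨z, ?_⟩
    change Multiplicative.ofAdd (Submodule.mkQ _ (Additive.ofMul (f z))) = x
    rw [hz]; exact hy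
  have hgk : ∀ x, x ∈ g.ker ↔ ∃ k : ℤ, f x = f (t ^ k) := by
    intro x
    rw [MonoidHom.mem_ker]
    change Submodule.mkQ (Submodule.span ℤ {a}) (Additive.ofMul (f x)) = 0 ↔ _
    rw [← LinearMap.mem_ker, Submodule.ker_mkQ, Submodule.mem_span_singleton]
    refine exists_congr fun k => ?_
    rw [map_zpow, ht, eq_comm]
    exact Iff.rfl
  let φ : Multiplicative ℤ →* MulAut H :=
    (MulAut.conjNormal : G →* MulAut H).comp (zpowersHom G t)
  let L : H ⋊[φ] Multiplicative ℤ →* G := SemidirectProduct.lift H.subtype (zpowersHom G t) (by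
    
    intro k
    ext x
    change ((MulAut.conjNormal (zpowersHom G t k) x : H) : G) = MulAut.conj (zpowersHom G t k) x
    rw [MulAut.conjNormal_apply, MulAut.conj_apply])
  have hLv : ∀ x, L x = x.left * t ^ (Multiplicative.toAdd x.right) := by
    intro x; rfl
  have hL : Function.Injective L := by
    rw [injective_iff_map_eq_one]
    intro x hx
    rw [hLv] at hx
    have h1 : f (t ^ (Multiplicative.toAdd x.right)) = 1 := by
      have : f x.left = 1 := by rw [← MonoidHom.mem_ker, hk]; exact x.left.2
      rw [← map_one f, ← hx, map_mul, this, one_mul]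
    have h2 : Multiplicative.toAdd x.right = 0 := by
      apply ha
      rw [map_zpow, ht] at h1
      exact h1
    rw [h2] at hx
    ext
    · simpa using hx
    · exact h2
  have hr : L.range = g.ker := by
    ext x
    rw [hgk]
    constructor
    · rintro ⟨y, rfl⟩
      refine ⟨Multiplicative.toAdd y.right, ?_⟩
      have : f y.left = 1 := by rw [← MonoidHom.mem_ker, hk]; exact y.left.2
      rw [hLv, map_mul, this, one_mul]
    · rintro ⟨k, hx⟩
      have : x * (t ^ k)⁻¹ ∈ H := by
        rw [← hk, MonoidHom.mem_ker, map_mul, map_inv, hx, mul_inv_cancel]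
      exact ⟨⟨⟨_, this⟩, Multiplicative.ofAdd k⟩, by rw [hLv]; simp⟩
  refine ⟨g.ker, inferInstance, ?_, ?_, ?_⟩
  · intro x hx
    have hx' : x ∈ f.ker := hk.symm ▸ hx
    rw [hgk]
    exact ⟨0, by rw [MonoidHom.mem_ker.1 hx']; simp⟩
  · rw [← hr, fp_iff]
    haveI := fp_semidirect hfp φ
    exact Group.IsFinitelyPresented.equiv (MonoidHom.ofInjective hL)
  · rw [rkQuot_eq g.ker inferInstance g hg rfl]
    exact hq

theorem steps {G : Type*} [Group G] (m d : ℕ) : ∀ (H : Subgroup G) (hHn : H.Normal)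
    (_ : commutator G ≤ H) (_ : FinitelyPresentedGroup H)
    (_ : rkQuot H hHn = m + d),
    ∃ (H' : Subgroup G) (hH'n : H'.Normal), H ≤ H' ∧ FinitelyPresentedGroup H' ∧
      rkQuot H' hH'n = m := by
  induction d with
  | zero => intro H h1 h2 h3 h4; exact ⟨H, h1, le_rfl, h3, h4⟩
  | succ d ih =>
    intro H h1 h2 h3 h4
    obtain ⟨K, k1, k2, k3, k4⟩ := step H h1 h2 h3 (m + d) h4
    obtain ⟨L, l1, l2, l3, l4⟩ := ih K k1 (h2.trans k2) k3 k4
    exact ⟨L, l1, k2.trans l2, l3, l4⟩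

/-- If there is a finitely presented normal fibre product (normal subdirect product)
`H ≤ G₁ × G₂` of co-rank `n`, then for every `0 < m < n` there is a finitely presented
normal fibre product of co-rank `m`. -/
theorem normal_fibre_product_corank_reduction {G₁ G₂ : Type*} [Group G₁] [Group G₂]
    (H : Subgroup (G₁ × G₂)) (hHn : H.Normal)
    (hsurj₁ : Subgroup.map (MonoidHom.fst G₁ G₂) H = ⊤)
    (hsurj₂ : Subgroup.map (MonoidHom.snd G₁ G₂) H = ⊤)
    (hcomm : (commutator G₁).prod (commutator G₂) ≤ H)
    (hfp : FinitelyPresentedGroup ↥H)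
    (n : ℕ) (hrk : rkQuot H hHn = n)
    (m : ℕ) (hm0 : 0 < m) (hmn : m < n) :
    ∃ (H' : Subgroup (G₁ × G₂)) (hH'n : H'.Normal),
      Subgroup.map (MonoidHom.fst G₁ G₂) H' = ⊤ ∧
      Subgroup.map (MonoidHom.snd G₁ G₂) H' = ⊤ ∧
      (commutator G₁).prod (commutator G₂) ≤ H' ∧
      FinitelyPresentedGroup ↥H' ∧ rkQuot H' hH'n = m := by
  have hc : commutator (G₁ × G₂) ≤ H := by
    refine le_trans (le_of_eq ?_) hcomm
    rw [commutator_def, commutator_def, commutator_def, ← Subgroup.commutator_prod_prod,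
      Subgroup.top_prod_top]
  obtain ⟨d, rfl⟩ := Nat.exists_eq_add_of_lt hmn
  obtain ⟨K, k1, k2, k3, k4⟩ := steps m (d + 1) H hHn hc hfp hrk
  exact ⟨K, k1, top_le_iff.1 (hsurj₁ ▸ Subgroup.map_mono k2),
    top_le_iff.1 (hsurj₂ ▸ Subgroup.map_mono k2), hcomm.trans k2, k3, k4⟩
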